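/- Normalization equivalent reduced TRSs are unique up to literal similarity: if R and S are reduced TRSs with →_R^! = →_S^!, then every rule of R has a variant in S and vice versa. -/

import Mathlib

namespace KB

-- Generic ARS notions
def NF {α : Type _} (r : α → α → Prop) (a : α) : Prop := ∀ b, ¬ r a b

def SymmCl {α : Type _} (r : α → α → Prop) (a b : α) : Prop := r a b ∨ r b a

def Conv {α : Type _} (r : α → α → Prop) : α → α → Prop :=
  Relation.ReflTransGen (SymmCl r)

def Joinable {α : Type _} (r : α → α → Prop) (a b : α) : Prop :=
  ∃ c, Relation.ReflTransGen r a c ∧ Relation.ReflTransGen r b c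

def Confluent {α : Type _} (r : α → α → Prop) : Prop :=
  ∀ a b c, Relation.ReflTransGen r a b → Relation.ReflTransGen r a c → Joinable r b c

def Terminating {α : Type _} (r : α → α → Prop) : Prop :=
  WellFounded (fun a b => r b a)

def Complete {α : Type _} (r : α → α → Prop) : Prop := Terminating r ∧ Confluent r

def NormTo {α : Type _} (r : α → α → Prop) (a b : α) : Prop :=
  Relation.ReflTransGen r a b ∧ NF r b

-- First-order terms
inductive Term (F V : Type) : Type where
  | var : V → Term F V
  | app : F → List (Term F V) → Term F V

variable {F V : Type}

def Term.subst (σ : V → Term F V) : Term F V → Term F V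
  | .var x => σ x
  | .app f ts => .app f (ts.attach.map fun t => Term.subst σ t.1)
decreasing_by
  simp only [Term.app.sizeOf_spec]
  have := List.sizeOf_lt_of_mem t.2
  omega

def Term.rename (π : V → V) (t : Term F V) : Term F V :=
  t.subst (fun x => Term.var (π x))

inductive Ctx (F V : Type) : Type where
  | hole : Ctx F V
  | cons : F → List (Term F V) → Ctx F V → List (Term F V) → Ctx F V

def Ctx.fill : Ctx F V → Term F V → Term F V
  | .hole, t => t
  | .cons f l C r, t => Term.app f (l ++ C.fill t :: r)

abbrev TRS (F V : Type) := Set (Term F V × Term F V)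

def Step (R : TRS F V) (s t : Term F V) : Prop :=
  ∃ (C : Ctx F V) (σ : V → Term F V) (l r : Term F V),
    (l, r) ∈ R ∧ s = C.fill (l.subst σ) ∧ t = C.fill (r.subst σ)

inductive InVars (x : V) : Term F V → Prop where
  | var : InVars x (Term.var x)
  | app {f : F} {ts : List (Term F V)} {t : Term F V} :
      t ∈ ts → InVars x t → InVars x (Term.app f ts)

def WellFormedRule (l r : Term F V) : Prop :=
  (∀ x : V, l ≠ Term.var x) ∧ ∀ x, InVars x r → InVars x l

def IsTRS (R : TRS F V) : Prop := ∀ p ∈ R, WellFormedRule p.1 p.2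

inductive Ground : Term F V → Prop where
  | app {f : F} {ts : List (Term F V)} : (∀ t ∈ ts, Ground t) → Ground (Term.app f ts)

def GroundSys (R : TRS F V) : Prop := ∀ p ∈ R, Ground p.1 ∧ Ground p.2

def LeftReduced (R : TRS F V) : Prop := ∀ p ∈ R, NF (Step (R \ {p})) p.1
def RightReduced (R : TRS F V) : Prop := ∀ p ∈ R, NF (Step R) p.2
def Reduced (R : TRS F V) : Prop := LeftReduced R ∧ RightReduced R

def RuleVariant (p q : Term F V × Term F V) : Prop :=
  ∃ π : V → V, Function.Bijective π ∧ p.1 = q.1.rename π ∧ p.2 = q.2.rename π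

def LitSim (R S : TRS F V) : Prop :=
  (∀ p ∈ R, ∃ q ∈ S, RuleVariant p q) ∧ (∀ q ∈ S, ∃ p ∈ R, RuleVariant q p)

def Encompass (s t : Term F V) : Prop :=
  ∃ (C : Ctx F V) (σ : V → Term F V), s = C.fill (t.subst σ)

def PEncompass (s t : Term F V) : Prop := Encompass s t ∧ ¬ Encompass t s

def ReductionOrder (gt : Term F V → Term F V → Prop) : Prop :=
  Transitive gt ∧ WellFounded (fun a b => gt b a) ∧
  (∀ (C : Ctx F V) s t, gt s t → gt (C.fill s) (C.fill t)) ∧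
  (∀ (σ : V → Term F V) s t, gt s t → gt (s.subst σ) (t.subst σ))

-- positions
def subt : List ℕ → Term F V → Option (Term F V)
  | [], t => some t
  | _ :: _, Term.var _ => none
  | i :: p, Term.app _ ts => (ts[i]?).bind (subt p)

def repl : List ℕ → Term F V → Term F V → Option (Term F V)
  | [], _, u => some u
  | _ :: _, Term.var _, _ => none
  | i :: p, Term.app f ts, u =>
      (ts[i]?).bind fun w => (repl p w u).map fun w' => Term.app f (ts.set i w')

def FunPos (p : List ℕ) (t : Term F V) : Prop :=
  ∃ f ts, subt p t = some (Term.app f ts)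

def Unifier (σ : V → Term F V) (s t : Term F V) : Prop := s.subst σ = t.subst σ

def IsMGU (σ : V → Term F V) (s t : Term F V) : Prop :=
  Unifier σ s t ∧ ∀ τ, Unifier τ s t → ∃ ρ, ∀ x, (σ x).subst ρ = τ x

def VarsDisjoint (p q : Term F V × Term F V) : Prop :=
  ∀ x, ¬ ((InVars x p.1 ∨ InVars x p.2) ∧ (InVars x q.1 ∨ InVars x q.2))

def Overlap (R : TRS F V) (l1 r1 : Term F V) (p : List ℕ) (l2 r2 : Term F V) : Prop :=
  (∃ q ∈ R, RuleVariant (l1, r1) q) ∧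
  (∃ q ∈ R, RuleVariant (l2, r2) q) ∧
  VarsDisjoint (l1, r1) (l2, r2) ∧
  FunPos p l2 ∧
  (∃ w, subt p l2 = some w ∧ ∃ σ, Unifier σ l1 w) ∧
  (p = [] → ¬ RuleVariant (l1, r1) (l2, r2))

def CPeak (R : TRS F V) (t : Term F V) (p : List ℕ) (s u : Term F V) : Prop :=
  ∃ (l1 r1 l2 r2 : Term F V) (σ : V → Term F V) (w : Term F V),
    Overlap R l1 r1 p l2 r2 ∧ subt p l2 = some w ∧ IsMGU σ l1 w ∧
    s = l2.subst σ ∧ u = r2.subst σ ∧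
    repl p (l2.subst σ) (r1.subst σ) = some t

def PrimeCPeak (R : TRS F V) (t : Term F V) (p : List ℕ) (s u : Term F V) : Prop :=
  CPeak R t p s u ∧
  ∀ w v, subt p s = some w → (∃ q, q ≠ [] ∧ subt q w = some v) → NF (Step R) v

def PCP (R : TRS F V) : Set (Term F V × Term F V) :=
  { e | ∃ p s, PrimeCPeak R e.1 p s e.2 }

def Nabla (R : TRS F V) (s u w : Term F V) : Prop :=
  Relation.TransGen (Step R) s u ∧ Relation.TransGen (Step R) s w ∧
  (Joinable (Step R) u w ∨ SymmCl (Step (PCP R)) u w)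

-- counted conversions and rewrite sequences
inductive ConvN {α : Type _} (r : α → α → Prop) : ℕ → ℕ → α → α → Prop where
  | refl (a : α) : ConvN r 0 0 a a
  | fwd {l n : ℕ} {a b c : α} : r a b → ConvN r l n b c → ConvN r l (n + 1) a c
  | bwd {l n : ℕ} {a b c : α} : r b a → ConvN r l n b c → ConvN r (l + 1) n a c

inductive StepsN {α : Type _} (r : α → α → Prop) : ℕ → α → α → Prop where
  | refl (a : α) : StepsN r 0 a a
  | step {n : ℕ} {a b c : α} : r a b → StepsN r n b c → StepsN r (n + 1) a c

def RandomDescent {α : Type _} (r : α → α → Prop) : Prop :=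
  ∀ l m a b, ConvN r l m a b → NF r b → ∃ n, StepsN r n a b ∧ n + l = m


@[simp]
theorem Term.subst_var (σ : V → Term F V) (x : V) : (Term.var x).subst σ = σ x := by
  rw [Term.subst]

@[simp]
theorem Term.subst_app (σ : V → Term F V) (f : F) (ts : List (Term F V)) :
    (Term.app f ts).subst σ = Term.app f (ts.map (Term.subst σ)) := by
  rw [Term.subst, List.map_attach_eq_pmap, List.pmap_eq_map]

/-- Structural induction on terms, with the hypothesis for all arguments of an application. -/
theorem Term.induction_args {P : Term F V → Prop} (var : ∀ x, P (.var x))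
    (app : ∀ f ts, (∀ t ∈ ts, P t) → P (.app f ts)) : ∀ t, P t
  | .var x => var x
  | .app f ts => app f ts fun t _ => Term.induction_args var app t

theorem Term.subst_subst (σ τ : V → Term F V) (t : Term F V) :
    (t.subst σ).subst τ = t.subst fun x => (σ x).subst τ := by
  induction t using Term.induction_args with
  | var x => simp
  | app f ts ih => simpa using ih

theorem Term.subst_id (t : Term F V) : t.subst Term.var = t := by
  induction t using Term.induction_args with
  | var x => simp
  | app f ts ih => simpa using (List.map_congr_left ih).trans (List.map_id' ts)

theorem Term.subst_eq_subst_iff {σ τ : V → Term F V} {t : Term F V} :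
    t.subst σ = t.subst τ ↔ ∀ x, InVars x t → σ x = τ x := by
  induction t using Term.induction_args with
  | var x =>
    simp only [Term.subst_var]
    exact ⟨fun h y hy => by cases hy; exact h, fun h => h x .var⟩
  | app f ts ih =>
    simp only [Term.subst_app, Term.app.injEq, true_and, List.map_inj_left]
    constructor
    · intro h x hx
      cases hx with
      | app ht hx => exact (ih _ ht).1 (h _ ht) x hx
    · exact fun h t ht => (ih t ht).2 fun x hx => h x (.app ht hx)

theorem Term.subst_eq_self_iff {σ : V → Term F V} {t : Term F V} :
    t.subst σ = t ↔ ∀ x, InVars x t → σ x = Term.var x := by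
  rw [← Term.subst_eq_subst_iff, Term.subst_id]

theorem Term.sizeOf_le_sizeOf_subst (σ : V → Term F V) (t : Term F V) :
    sizeOf t ≤ sizeOf (t.subst σ) := by
  induction t using Term.induction_args with
  | var x =>
    cases h : σ x <;> simp [h]
  | app f ts ih =>
    have : sizeOf ts ≤ sizeOf (ts.map (Term.subst σ)) := by
      induction ts with
      | nil => simp
      | cons t ts ihts =>
        have h₁ := ih t (by simp)
        have h₂ := ihts fun u hu => ih u (by simp [hu])
        simp only [List.map_cons, List.cons.sizeOf_spec]
        omega
    simpa using this

theorem Term.finite_vars (t : Term F V) : {x | InVars x t}.Finite := by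
  induction t using Term.induction_args with
  | var x => exact (Set.finite_singleton x).subset fun y hy => by cases hy; rfl
  | app f ts ih =>
    refine (ts.finite_toSet.biUnion ih).subset fun x hx => ?_
    cases hx with
    | app ht hx => exact Set.mem_biUnion ht hx

theorem Ctx.sizeOf_lt_sizeOf_fill_cons (f : F) (ls : List (Term F V)) (C : Ctx F V)
    (rs : List (Term F V)) (t : Term F V) :
    sizeOf (C.fill t) < sizeOf ((Ctx.cons f ls C rs).fill t) := by
  have := List.sizeOf_lt_of_mem (a := C.fill t) (as := ls ++ C.fill t :: rs) (by simp)
  simp only [Ctx.fill, Term.app.sizeOf_spec]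
  omega

theorem Ctx.sizeOf_le_sizeOf_fill (C : Ctx F V) (t : Term F V) :
    sizeOf t ≤ sizeOf (C.fill t) := by
  induction C with
  | hole => exact le_rfl
  | cons f ls C rs ih => exact ih.trans (C.sizeOf_lt_sizeOf_fill_cons f ls rs t).le

theorem Ctx.eq_hole_of_sizeOf_fill_le {C : Ctx F V} {t : Term F V}
    (h : sizeOf (C.fill t) ≤ sizeOf t) : C = .hole := by
  cases C with
  | hole => rfl
  | cons f ls C rs =>
    have h₁ := C.sizeOf_lt_sizeOf_fill_cons f ls rs t
    have h₂ := C.sizeOf_le_sizeOf_fill t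
    omega

/-- The composition of contexts. -/
def Ctx.comp : Ctx F V → Ctx F V → Ctx F V
  | .hole, D => D
  | .cons f ls C rs, D => .cons f ls (C.comp D) rs

theorem Ctx.fill_comp (C D : Ctx F V) (t : Term F V) :
    (C.comp D).fill t = C.fill (D.fill t) := by
  induction C with
  | hole => rfl
  | cons f ls C rs ih => simp [Ctx.comp, Ctx.fill, ih]

/-- The application of a substitution to a context. -/
def Ctx.subst (σ : V → Term F V) : Ctx F V → Ctx F V
  | .hole => .hole
  | .cons f ls C rs => .cons f (ls.map (Term.subst σ)) (C.subst σ) (rs.map (Term.subst σ))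

theorem Ctx.subst_fill (σ : V → Term F V) (C : Ctx F V) (t : Term F V) :
    (C.fill t).subst σ = (C.subst σ).fill (t.subst σ) := by
  induction C with
  | hole => rfl
  | cons f ls C rs ih => simp [Ctx.subst, Ctx.fill, ih]

theorem Step.of_mem {R : TRS F V} {p : Term F V × Term F V} (hp : p ∈ R) : Step R p.1 p.2 :=
  ⟨.hole, Term.var, p.1, p.2, hp, by simp [Ctx.fill, Term.subst_id],
    by simp [Ctx.fill, Term.subst_id]⟩

theorem Step.subst {R : TRS F V} {s t : Term F V} (h : Step R s t) (σ : V → Term F V) :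
    Step R (s.subst σ) (t.subst σ) := by
  obtain ⟨C, τ, l, r, hlr, rfl, rfl⟩ := h
  exact ⟨C.subst σ, fun x => (τ x).subst σ, l, r, hlr,
    by rw [Ctx.subst_fill, Term.subst_subst], by rw [Ctx.subst_fill, Term.subst_subst]⟩

theorem Step.fill {R : TRS F V} {s t : Term F V} (h : Step R s t) (C : Ctx F V) :
    Step R (C.fill s) (C.fill t) := by
  obtain ⟨D, τ, l, r, hlr, rfl, rfl⟩ := h
  exact ⟨C.comp D, τ, l, r, hlr, (C.fill_comp D _).symm, (C.fill_comp D _).symm⟩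

/-- Normal forms are stable under substitutions that have a left inverse on the variables. -/
theorem NF.subst {R : TRS F V} {t : Term F V} (h : NF (Step R) t) {σ τ : V → Term F V}
    (hστ : (t.subst σ).subst τ = t) : NF (Step R) (t.subst σ) :=
  fun u hu => h (u.subst τ) (hστ ▸ hu.subst τ)

theorem Term.exists_eq_var_of_subst_eq_var {σ : V → Term F V} {t : Term F V} {x : V}
    (h : t.subst σ = Term.var x) : ∃ y, t = Term.var y := by
  cases t with
  | var y => exact ⟨y, rfl⟩
  | app f ts => simp at h

/-- A map that is injective on a finite set agrees there with some permutation. -/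
theorem exists_perm_eqOn {α : Type*} {s : Set α} (hs : s.Finite) {g : α → α}
    (hg : Set.InjOn g s) : ∃ π : Equiv.Perm α, Set.EqOn π g s := by
  classical
  induction s, hs using Set.Finite.induction_on with
  | empty => exact ⟨1, Set.eqOn_empty _ _⟩
  | @insert a s ha _ ih =>
    obtain ⟨π, hπ⟩ := ih (hg.mono (Set.subset_insert a s))
    refine ⟨π.trans (Equiv.swap (π a) (g a)), fun x hx => ?_⟩
    rcases Set.mem_insert_iff.1 hx with rfl | hxs
    · simp
    · have hxa : x ≠ a := fun h => ha (h ▸ hxs)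
      rw [Equiv.trans_apply, Equiv.swap_apply_of_ne_of_ne (π.injective.ne hxa), hπ hxs]
      rw [hπ hxs]
      exact fun h => hxa (hg hx (Set.mem_insert a s) h)

/-- A substitution with a left inverse on the variables of `t` acts on them as a permutation. -/
theorem Term.exists_perm_of_subst_subst_eq_self {σ τ : V → Term F V} {t : Term F V}
    (h : (t.subst σ).subst τ = t) :
    ∃ π : Equiv.Perm V, ∀ x, InVars x t → σ x = Term.var (π x) := by
  rw [Term.subst_subst, Term.subst_eq_self_iff] at h
  have hvar : ∀ x, ∃ y, InVars x t → σ x = Term.var y := fun x => by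
    by_cases hx : InVars x t
    · obtain ⟨y, hy⟩ := Term.exists_eq_var_of_subst_eq_var (h x hx)
      exact ⟨y, fun _ => hy⟩
    · exact ⟨x, fun hx' => absurd hx' hx⟩
  choose g hg using hvar
  have hinj : Set.InjOn g {x | InVars x t} := fun x hx y hy hxy => by
    have h₁ := h x hx
    rw [hg x hx, hxy, ← hg y hy, h y hy] at h₁
    exact (Term.var.inj h₁).symm
  obtain ⟨π, hπ⟩ := exists_perm_eqOn t.finite_vars hinj
  exact ⟨π, fun x hx => by rw [hg x hx, hπ hx]⟩

theorem exists_step_of_normTo {α : Type*} {r r' : α → α → Prop} {a b : α} (h : r a b)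
    (hb : NF r b) (hNE : NormTo r a b → NormTo r' a b) :
    ∃ c, r' a c ∧ Relation.ReflTransGen r' c b := by
  rcases (hNE ⟨.single h, hb⟩).1.cases_head with rfl | hc
  · exact absurd h (hb a)
  · exact hc

/-- Every rule of a reduced TRS `R` has a variant in any right-reduced TRS `S` with the same
normalization relation. -/
theorem exists_ruleVariant_of_normTo_iff {R S : TRS F V} (hS : IsTRS S) (hRred : Reduced R)
    (hSred : RightReduced S)
    (hNE : ∀ a b, NormTo (Step R) a b ↔ NormTo (Step S) a b)
    {p : Term F V × Term F V} (hp : p ∈ R) : ∃ q ∈ S, RuleVariant p q := by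
  obtain ⟨s, ⟨C, σ, l', r', hq, hl, rfl⟩, hsr⟩ :=
    exists_step_of_normTo (Step.of_mem hp) (hRred.2 p hp) (hNE _ _).1
  obtain ⟨_, ⟨D, τ, l'', r'', hp', hl', -⟩, -⟩ :=
    exists_step_of_normTo (Step.of_mem hq) (hSred _ hq) (hNE _ _).2
  dsimp only at hl'
  have hpp : (l'', r'') = p := by
    by_contra hne
    have hstep : Step (R \ {p}) l' (D.fill (r''.subst τ)) :=
      ⟨D, τ, l'', r'', ⟨hp', hne⟩, hl', rfl⟩
    exact hRred.1 p hp _ (hl ▸ (hstep.subst σ).fill C)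
  subst hpp
  dsimp only at hl hsr
  have h₁ := C.sizeOf_le_sizeOf_fill (l'.subst σ)
  have h₂ := Term.sizeOf_le_sizeOf_subst σ l'
  have h₃ := D.sizeOf_le_sizeOf_fill (l''.subst τ)
  have h₄ := Term.sizeOf_le_sizeOf_subst τ l''
  rw [← hl] at h₁
  rw [← hl'] at h₃
  obtain rfl : C = .hole := Ctx.eq_hole_of_sizeOf_fill_le (t := l'.subst σ) (by rw [← hl]; omega)
  obtain rfl : D = .hole := Ctx.eq_hole_of_sizeOf_fill_le (t := l''.subst τ) (by rw [← hl']; omega)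
  simp only [Ctx.fill] at hl hl' hsr
  have hinv : (l'.subst σ).subst τ = l' := by rw [← hl, ← hl']
  have hvars := (hS _ hq).2
  have hinv' : (r'.subst σ).subst τ = r' := by
    rw [Term.subst_subst, Term.subst_eq_self_iff] at hinv ⊢
    exact fun x hx => hinv x (hvars x hx)
  have hr : r'' = r'.subst σ := by
    rcases hsr.cases_head with h | ⟨c, hc, -⟩
    · exact h.symm
    · exact absurd hc ((hSred _ hq).subst hinv' c)
  obtain ⟨π, hπ⟩ := Term.exists_perm_of_subst_subst_eq_self hinv
  refine ⟨(l', r'), hq, π, π.bijective, ?_, ?_⟩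
  · exact hl.trans (Term.subst_eq_subst_iff.2 hπ)
  · exact hr.trans (Term.subst_eq_subst_iff.2 fun x hx => hπ x (hvars x hx))

/-- Normalization equivalent reduced TRSs are unique up to literal similarity. -/
theorem reduced_NE_unique {F V : Type} (R S : TRS F V)
    (hR : IsTRS R) (hS : IsTRS S)
    (hRred : Reduced R) (hSred : Reduced S)
    (hNE : ∀ a b, NormTo (Step R) a b ↔ NormTo (Step S) a b) :
    LitSim R S := by
  exact ⟨fun _ hp => exists_ruleVariant_of_normTo_iff hS hRred hSred.2 hNE hp,
    fun _ hq => exists_ruleVariant_of_normTo_iff hR hSred hRred.2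
      (fun a b => (hNE a b).symm) hq⟩

end KB
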